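/- Let G be any directed mixed graph and J, K, L ⊆ Ṽ ⊆ V. Then there exist j ∈ J and k ∈ K with j tconn k | L in marg_Ṽ(G) if and only if there exist j ∈ J and k ∈ K with j tconn k | L in G. -/

import Mathlib

/-! ### Walks on directed mixed graphs -/

/-- How an edge is traversed by a walk. -/
inductive EKind : Type
  | fwd   -- a directed edge traversed forwards:  `a → b`
  | bwd   -- a directed edge traversed backwards: `a ← b` (the edge is `b → a`)
  | bidir -- a bidirected edge: `a ↔ b`
  deriving DecidableEq

/-- A directed mixed graph on vertex type `V` (directed edges `dir`, bidirected
edges `bi`; loops are allowed). -/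
structure MixedGraph (V : Type*) where
  dir : V → V → Prop
  bi : V → V → Prop

/-- A candidate walk: a starting vertex together with a list of steps; each step
records how the next edge is traversed and the next vertex reached. -/
structure MWalk (V : Type*) where
  head : V
  tail : List (EKind × V)

namespace MWalk

variable {V : Type*}

/-- The last vertex of a walk. -/
def last (w : MWalk V) : V := (w.tail.map Prod.snd).getLastD w.head

/-- The list of vertex occurrences of a walk. -/
def verts (w : MWalk V) : List V := w.head :: w.tail.map Prod.snd

/-- The length (number of edge-traversals) of a walk. -/
def length (w : MWalk V) : ℕ := w.tail.length

/-- The non-endpoint (interior) vertex occurrences of a walk. -/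
def interior (w : MWalk V) : List V := (w.tail.map Prod.snd).dropLast

/-- Does this kind of traversal have an arrowhead at its end vertex? -/
def arrowAtEnd : EKind → Bool
  | .fwd => true
  | .bwd => false
  | .bidir => true

/-- Does this kind of traversal have an arrowhead at its start vertex? -/
def arrowAtStart : EKind → Bool
  | .fwd => false
  | .bwd => true
  | .bidir => true

/-- The interior vertex occurrence reached by step `i` (present when
`i + 1 < w.tail.length`) is a collider. -/
def ColliderAt (w : MWalk V) (i : ℕ) : Prop :=
  ∃ s t : EKind × V, w.tail[i]? = some s ∧ w.tail[i + 1]? = some t ∧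
    arrowAtEnd s.1 = true ∧ arrowAtStart t.1 = true

/-- The walk contains no collider. -/
def NoCollider (w : MWalk V) : Prop := ∀ i, ¬ w.ColliderAt i

/-- Validity in `G` of a list of steps starting at a given vertex. -/
def Valid (G : MixedGraph V) : V → List (EKind × V) → Prop
  | _, [] => True
  | a, s :: rest =>
      (match s.1 with
        | EKind.fwd => G.dir a s.2
        | EKind.bwd => G.dir s.2 a
        | EKind.bidir => G.bi a s.2) ∧ Valid G s.2 rest

/-- `w` is a walk (with at least one edge) in `G`. -/
def IsWalk (G : MixedGraph V) (w : MWalk V) : Prop := w.tail ≠ [] ∧ Valid G w.head w.tail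

/-- `w` is a walk in `G` from `j` to `k`. -/
def IsWalkFrom (G : MixedGraph V) (w : MWalk V) (j k : V) : Prop :=
  IsWalk G w ∧ w.head = j ∧ w.last = k

/-- A right-directed walk: all directed edges traversed forwards. -/
def IsRightDirected (w : MWalk V) : Prop := ∀ s ∈ w.tail, s.1 = EKind.fwd

/-- A left-directed walk: all directed edges traversed backwards. -/
def IsLeftDirected (w : MWalk V) : Prop := ∀ s ∈ w.tail, s.1 = EKind.bwd

/-- A walk using only directed edges (traversed in either direction). -/
def DirectedOnly (w : MWalk V) : Prop := ∀ s ∈ w.tail, s.1 ≠ EKind.bidir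

/-- A trek: a (possibly empty) left leg of directed edges traversed backwards,
then exactly one bidirected edge, then a (possibly empty) right leg of directed
edges traversed forwards. -/
def IsTrek (w : MWalk V) : Prop :=
  ∃ (l : List (EKind × V)) (b : EKind × V) (r : List (EKind × V)),
    w.tail = l ++ b :: r ∧ (∀ s ∈ l, s.1 = EKind.bwd) ∧ b.1 = EKind.bidir ∧
      (∀ s ∈ r, s.1 = EKind.fwd)

/-- A d-connected walk: directed edges traversed backwards followed by directed
edges traversed forwards, at least one edge in total. -/
def IsDConnWalk (w : MWalk V) : Prop :=
  w.tail ≠ [] ∧ ∃ l r : List (EKind × V), w.tail = l ++ r ∧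
    (∀ s ∈ l, s.1 = EKind.bwd) ∧ (∀ s ∈ r, s.1 = EKind.fwd)

/-- An arc (m-connected walk): a trek or a d-connected walk. -/
def IsArc (w : MWalk V) : Prop := IsTrek w ∨ IsDConnWalk w

/-- A path: a walk visiting no vertex more than once. -/
def IsPath (w : MWalk V) : Prop := w.verts.Nodup

/-- The number of bidirected edges traversed by the walk. -/
def bidirCount (w : MWalk V) : ℕ := w.tail.countP (fun s => decide (s.1 = EKind.bidir))

/-- `w` is blocked by `L`: some collider on it lies outside `L`, or some
non-collider non-endpoint on it lies in `L`. -/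
def Blocked (w : MWalk V) (L : Set V) : Prop :=
  ∃ (i : ℕ) (v : V), i + 1 < w.tail.length ∧ (w.tail[i]?).map Prod.snd = some v ∧
    ((w.ColliderAt i ∧ v ∉ L) ∨ (¬ w.ColliderAt i ∧ v ∈ L))

/-- A collider-connected walk: all non-endpoints are colliders. -/
def IsColliderConnected (w : MWalk V) : Prop := ∀ i, i + 1 < w.tail.length → w.ColliderAt i

/-- The weight of a list of steps starting from a given vertex: `β l m` for a
traversal (in either direction) of the directed edge `l → m` and `Λ l m` for a
traversal of the bidirected edge `l ↔ m`. -/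
def weightFrom (β Λ : V → V → ℝ) : V → List (EKind × V) → ℝ
  | _, [] => 1
  | a, s :: rest =>
      (match s.1 with
        | EKind.fwd => β a s.2
        | EKind.bwd => β s.2 a
        | EKind.bidir => Λ a s.2) * weightFrom β Λ s.2 rest

/-- The weight of a walk. -/
def weight (β Λ : V → V → ℝ) (w : MWalk V) : ℝ := weightFrom β Λ w.head w.tail

end MWalk

namespace MixedGraph

variable {V : Type*}

/-- The bidirected edge relation is symmetric. -/
def BiSymm (G : MixedGraph V) : Prop := ∀ j k, G.bi j k → G.bi k j

/-- Canonical: every vertex carries a bidirected loop. -/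
def Canonical (G : MixedGraph V) : Prop := ∀ v, G.bi v v

/-- Canonically directed: the bidirected edges are exactly the loops. -/
def CanonicallyDirected (G : MixedGraph V) : Prop := ∀ j k, G.bi j k ↔ j = k

/-- There is a right-directed walk from `j` to `k` in `G`. -/
def RDConn (G : MixedGraph V) (j k : V) : Prop :=
  ∃ w : MWalk V, MWalk.IsWalkFrom G w j k ∧ w.IsRightDirected

/-- Acyclicity: no right-directed walk from a vertex to itself. -/
def Acyclic (G : MixedGraph V) : Prop := ∀ v, ¬ G.RDConn v v

/-- Remove all bidirected loops. -/
def trim (G : MixedGraph V) : MixedGraph V where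
  dir := G.dir
  bi j k := G.bi j k ∧ j ≠ k

/-- m-connection given `L`: some walk from `j` to `k` is not blocked by `L`. -/
def MConn (G : MixedGraph V) (j k : V) (L : Set V) : Prop :=
  ∃ w : MWalk V, MWalk.IsWalkFrom G w j k ∧ ¬ w.Blocked L

/-- d-connection given `L`: some walk from `j` to `k` using only directed edges
is not blocked by `L`. -/
def DConn (G : MixedGraph V) (j k : V) (L : Set V) : Prop :=
  ∃ w : MWalk V, MWalk.IsWalkFrom G w j k ∧ w.DirectedOnly ∧ ¬ w.Blocked L

/-- `w` is ancestrally blocked by `L`: it contains a collider `v ∉ L` with no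
right-directed walk from `v` to a member of `L`, or a non-collider non-endpoint
in `L`. -/
def AncBlocked (G : MixedGraph V) (w : MWalk V) (L : Set V) : Prop :=
  ∃ (i : ℕ) (v : V), i + 1 < w.tail.length ∧ (w.tail[i]?).map Prod.snd = some v ∧
    ((w.ColliderAt i ∧ v ∉ L ∧ ¬ ∃ l ∈ L, G.RDConn v l) ∨ (¬ w.ColliderAt i ∧ v ∈ L))

/-- The marginal graph (latent projection) of `G` on `T`. -/
def marg (G : MixedGraph V) (T : Set V) : MixedGraph V where
  dir j k := j ∈ T ∧ k ∈ T ∧ ∃ w : MWalk V, MWalk.IsWalkFrom G w j k ∧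
      w.IsRightDirected ∧ ∀ v ∈ w.interior, v ∉ T
  bi j k := j ∈ T ∧ k ∈ T ∧ ∃ w : MWalk V, MWalk.IsWalkFrom G w j k ∧
      w.IsTrek ∧ ∀ v ∈ w.interior, v ∉ T

/-- t-connection given `L`: a concatenation of treks, each not blocked by `L`,
with consecutive treks meeting at vertices belonging to `L`. -/
inductive TConn (G : MixedGraph V) (L : Set V) : V → V → Prop
  | single {j k : V} (w : MWalk V) (hw : MWalk.IsWalkFrom G w j k) (ht : w.IsTrek)
      (hb : ¬ w.Blocked L) : TConn G L j k
  | cons {j m k : V} (w : MWalk V) (hw : MWalk.IsWalkFrom G w j m) (ht : w.IsTrek)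
      (hb : ¬ w.Blocked L) (hm : m ∈ L) (h : TConn G L m k) : TConn G L j k

end MixedGraph

namespace MargAux

open MWalk MixedGraph

variable {V : Type*}

inductive Leg (G : MixedGraph V) (S : Set V) : V → V → Prop
  | refl (k : V) : Leg G S k k
  | step {a b k : V} (ha : a ∉ S) (hd : G.dir a b) (h : Leg G S b k) : Leg G S a k

theorem Leg.trans {G : MixedGraph V} {S : Set V} {a b c : V} (h : Leg G S a b)
    (h' : Leg G S b c) : Leg G S a c := by
  induction h with
  | refl => exact h'
  | step ha hd _ ih => exact .step ha hd (ih h')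

theorem Leg.mono {G : MixedGraph V} {S S' : Set V} (hS : S' ⊆ S) {a b : V} (h : Leg G S a b) :
    Leg G S' a b := by
  induction h with
  | refl => exact .refl _
  | step ha hd _ ih => exact .step (fun h => ha (hS h)) hd ih

def lastV (a : V) (l : List (EKind × V)) : V := (l.map Prod.snd).getLastD a

@[simp] theorem lastV_nil (a : V) : lastV a [] = a := rfl

@[simp] theorem lastV_cons (a : V) (s : EKind × V) (l) : lastV a (s :: l) = lastV s.2 l := by
  unfold lastV
  rw [List.map_cons, List.getLastD_cons]

theorem lastV_append (a : V) (l r) : lastV a (l ++ r) = lastV (lastV a l) r := by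
  induction l generalizing a with
  | nil => rfl
  | cons s l ih => simp [ih]

theorem valid_append (G : MixedGraph V) (a : V) (l r) :
    Valid G a (l ++ r) ↔ Valid G a l ∧ Valid G (lastV a l) r := by
  induction l generalizing a with
  | nil => simp [Valid]
  | cons s l ih => simp [Valid, ih, and_assoc]

theorem leg_of_fwd {G : MixedGraph V} {S : Set V} (r : List (EKind × V)) : ∀ (a : V),
    Valid G a r → (∀ s ∈ r, s.1 = EKind.fwd) → (∀ v ∈ (a :: r.map Prod.snd).dropLast, v ∉ S) →
    Leg G S a (lastV a r) := by
  induction r with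
  | nil => intro a _ _ _; exact .refl _
  | cons s r ih =>
    obtain ⟨k, b⟩ := s
    intro a hv hf hS
    obtain rfl : k = EKind.fwd := hf (k, b) (by simp)
    rw [lastV_cons]
    refine .step (hS a (by simp)) hv.1 (ih b hv.2 (fun s hs => hf s (by simp [hs])) ?_)
    intro v h
    exact hS v (by simp only [List.map_cons, List.dropLast_cons_cons]; exact List.mem_cons_of_mem _ h)

theorem fwd_of_leg {G : MixedGraph V} {S : Set V} {a k : V} (h : Leg G S a k) :
    ∃ r : List (EKind × V), Valid G a r ∧ (∀ s ∈ r, s.1 = EKind.fwd) ∧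
      (∀ v ∈ (a :: r.map Prod.snd).dropLast, v ∉ S) ∧ lastV a r = k := by
  induction h with
  | refl k => exact ⟨[], trivial, by simp, by simp, rfl⟩
  | @step a b k ha hd _ ih =>
    obtain ⟨r, h1, h2, h3, h4⟩ := ih
    refine ⟨(EKind.fwd, b) :: r, ⟨hd, h1⟩, ?_, ?_, by simpa using h4⟩
    · intro s hs
      rcases List.mem_cons.1 hs with rfl | hs
      · rfl
      · exact h2 s hs
    · intro v hv
      simp only [List.map_cons, List.dropLast_cons_cons] at hv
      rcases List.mem_cons.1 hv with rfl | hv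
      · exact ha
      · exact h3 v hv

theorem leg_of_bwd {G : MixedGraph V} {S : Set V} (l : List (EKind × V)) : ∀ (j : V),
    Valid G j l → (∀ s ∈ l, s.1 = EKind.bwd) → (∀ v ∈ l.map Prod.snd, v ∉ S) →
    Leg G S (lastV j l) j := by
  induction l with
  | nil => intro a _ _ _; exact .refl _
  | cons s r ih =>
    obtain ⟨k, b⟩ := s
    intro a hv hf hS
    obtain rfl : k = EKind.bwd := hf (k, b) (by simp)
    rw [lastV_cons]
    refine (ih b hv.2 (fun s hs => hf s (by simp [hs])) ?_).trans
      (.step (hS b (by simp)) hv.1 (.refl _))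
    intro v h
    exact hS v (by rw [List.map_cons]; exact List.mem_cons_of_mem _ h)

theorem bwd_of_leg {G : MixedGraph V} {S : Set V} {a j : V} (h : Leg G S a j) :
    ∃ l : List (EKind × V), Valid G j l ∧ (∀ s ∈ l, s.1 = EKind.bwd) ∧
      (∀ v ∈ l.map Prod.snd, v ∉ S) ∧ lastV j l = a := by
  induction h with
  | refl k => exact ⟨[], trivial, by simp, by simp, rfl⟩
  | @step a b k ha hd _ ih =>
    obtain ⟨r, h1, h2, h3, h4⟩ := ih
    refine ⟨r ++ [(EKind.bwd, a)], ?_, ?_, ?_, by simp [lastV_append]⟩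
    · rw [valid_append, h4]
      exact ⟨h1, hd, trivial⟩
    · intro s hs
      rcases List.mem_append.1 hs with hs | hs
      · exact h2 s hs
      · rw [List.mem_singleton.1 hs]
    · intro v hv
      rw [List.map_append] at hv
      rcases List.mem_append.1 hv with hv | hv
      · exact h3 v hv
      · obtain rfl : v = a := by simpa using hv
        exact ha

def Tr (G : MixedGraph V) (S : Set V) (j k : V) : Prop :=
  ∃ a b, Leg G S a j ∧ G.bi a b ∧ Leg G S b k

theorem interior_eq (w : MWalk V) (l b r) (h : w.tail = l ++ b :: r) :
    w.interior = l.map Prod.snd ++ (b.2 :: r.map Prod.snd).dropLast := by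
  unfold MWalk.interior
  rw [h, List.map_append, List.map_cons, List.dropLast_append_of_ne_nil (by simp)]

theorem trek_iff (G : MixedGraph V) (S : Set V) (j k : V) :
    (∃ w : MWalk V, IsWalkFrom G w j k ∧ w.IsTrek ∧ ∀ v ∈ w.interior, v ∉ S) ↔ Tr G S j k := by
  constructor
  · rintro ⟨w, ⟨⟨_, hv⟩, hj, hk⟩, ⟨l, b, r, he, hl, hb, hr⟩, hi⟩
    rw [interior_eq w l b r he] at hi
    have hk' : lastV w.head w.tail = k := hk
    rw [he, lastV_append, lastV_cons] at hk'
    rw [he, valid_append] at hv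
    rw [hj] at hv
    obtain ⟨hv1, hv2⟩ := hv
    obtain ⟨kb, b⟩ := b
    obtain rfl : kb = EKind.bidir := hb
    refine ⟨lastV j l, b, leg_of_bwd l j hv1 hl (fun v h => hi v (List.mem_append_left _ h)),
      hv2.1, ?_⟩
    rw [← hk']
    exact leg_of_fwd r b hv2.2 hr (fun v h => hi v (List.mem_append_right _ h))
  · rintro ⟨a, b, h1, hb, h2⟩
    obtain ⟨l, l1, l2, l3, l4⟩ := bwd_of_leg h1
    obtain ⟨r, r1, r2, r3, r4⟩ := fwd_of_leg h2
    refine ⟨⟨j, l ++ (EKind.bidir, b) :: r⟩, ⟨⟨by simp, ?_⟩, rfl, ?_⟩,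
      ⟨l, (EKind.bidir, b), r, rfl, l2, rfl, r2⟩, ?_⟩
    · rw [valid_append]
      refine ⟨l1, ?_, r1⟩
      rw [l4]; exact hb
    · change lastV j (l ++ (EKind.bidir, b) :: r) = k
      rw [lastV_append, lastV_cons, r4]
    · rw [interior_eq _ l (EKind.bidir, b) r rfl]
      intro v hv
      rcases List.mem_append.1 hv with hv | hv
      · exact l3 v hv
      · exact r3 v hv

theorem dir_iff (G : MixedGraph V) (S : Set V) (j k : V) :
    (∃ w : MWalk V, IsWalkFrom G w j k ∧ w.IsRightDirected ∧ ∀ v ∈ w.interior, v ∉ S) ↔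
      ∃ b, G.dir j b ∧ Leg G S b k := by
  constructor
  · rintro ⟨⟨h, t⟩, ⟨⟨hne, hv⟩, hj, hk⟩, hr, hi⟩
    cases t with
    | nil => exact absurd rfl hne
    | cons s r =>
      obtain ⟨ks, b⟩ := s
      obtain rfl : ks = EKind.fwd := hr (ks, b) (by simp)
      have hk' : lastV h ((EKind.fwd, b) :: r) = k := hk
      rw [lastV_cons] at hk'
      have hj' : h = j := hj
      subst hj'
      refine ⟨b, hv.1, ?_⟩
      rw [← hk']
      exact leg_of_fwd r b hv.2 (fun s hs => hr s (List.mem_cons_of_mem _ hs)) hi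
  · rintro ⟨b, hb, h2⟩
    obtain ⟨r, r1, r2, r3, r4⟩ := fwd_of_leg h2
    refine ⟨⟨j, (EKind.fwd, b) :: r⟩, ⟨⟨by simp, hb, r1⟩, rfl, ?_⟩, ?_, r3⟩
    · change lastV j ((EKind.fwd, b) :: r) = k
      rw [lastV_cons, r4]
    · intro s hs
      rcases List.mem_cons.1 hs with rfl | hs
      · rfl
      · exact r2 s hs

theorem noCollider (w : MWalk V) (h : w.IsTrek) (i : ℕ) : ¬ w.ColliderAt i := by
  rintro ⟨s, t, hs, ht, h1, h2⟩
  obtain ⟨l, b, r, he, hl, hb, hr⟩ := h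
  rw [he] at hs ht
  rcases lt_or_ge i l.length with hi | hi
  · rw [List.getElem?_append_left hi] at hs
    rw [hl s (List.mem_of_getElem? hs)] at h1
    cases h1
  · rw [List.getElem?_append_right (by omega)] at ht
    rw [show i + 1 - l.length = (i - l.length) + 1 by omega, List.getElem?_cons_succ] at ht
    rw [hr t (List.mem_of_getElem? ht)] at h2
    cases h2

theorem not_blocked_iff (w : MWalk V) (h : w.IsTrek) (L : Set V) :
    ¬ w.Blocked L ↔ ∀ v ∈ w.interior, v ∉ L := by
  constructor
  · intro hb v hv hvL
    obtain ⟨i, hi, hiv⟩ := List.mem_iff_getElem.1 hv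
    have hi' : i < (w.tail.map Prod.snd).length - 1 := by
      simpa [MWalk.interior] using hi
    rw [List.length_map] at hi'
    refine hb ⟨i, v, by omega, ?_, Or.inr ⟨noCollider w h i, hvL⟩⟩
    have : i < w.tail.length := by omega
    simp [MWalk.interior] at hiv
    simp [this, hiv]
  · rintro hb ⟨i, v, hi, hv, h' | h'⟩
    · exact noCollider w h i h'.1
    · refine hb v ?_ h'.2
      have h1 : i < w.tail.length := by omega
      refine List.mem_iff_getElem.2 ⟨i, by simp [MWalk.interior]; omega, ?_⟩
      simp [h1] at hv
      simp [MWalk.interior, hv]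

theorem trek_iff' (G : MixedGraph V) (S : Set V) (j k : V) :
    (∃ w : MWalk V, IsWalkFrom G w j k ∧ w.IsTrek ∧ ¬ w.Blocked S) ↔ Tr G S j k := by
  rw [← trek_iff]
  constructor
  · rintro ⟨w, h1, h2, h3⟩; exact ⟨w, h1, h2, (not_blocked_iff w h2 S).1 h3⟩
  · rintro ⟨w, h1, h2, h3⟩; exact ⟨w, h1, h2, (not_blocked_iff w h2 S).2 h3⟩

theorem leg_marg {G : MixedGraph V} {T L : Set V} (hL : L ⊆ T) {a j : V}
    (h : Leg (G.marg T) L a j) : Leg G L a j := by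
  induction h with
  | refl => exact .refl _
  | step ha hd _ ih =>
    obtain ⟨c, hc, hl⟩ := (dir_iff _ _ _ _).1 hd.2.2
    exact .step ha hc ((hl.mono hL).trans ih)

theorem leg_to_marg {G : MixedGraph V} {T L : Set V} {a j : V}
    (h : Leg G L a j) (hj : j ∈ T) : ∃ a' ∈ T, Leg G T a a' ∧ Leg (G.marg T) L a' j := by
  induction h with
  | refl => exact ⟨_, hj, .refl _, .refl _⟩
  | @step a b k ha hd _ ih =>
    obtain ⟨a', ha', h1, h2⟩ := ih hj
    by_cases haT : a ∈ T
    · exact ⟨a, haT, .refl _, .step ha ⟨haT, ha', (dir_iff _ _ _ _).2 ⟨b, hd, h1⟩⟩ h2⟩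
    · exact ⟨a', ha', .step haT hd h1, h2⟩

theorem tr_iff {G : MixedGraph V} {T L : Set V} (hL : L ⊆ T) {j k : V} (hj : j ∈ T)
    (hk : k ∈ T) : Tr (G.marg T) L j k ↔ Tr G L j k := by
  constructor
  · rintro ⟨a, b, h1, hb, h2⟩
    obtain ⟨a', b', h1', hb', h2'⟩ := (trek_iff _ _ _ _).1 hb.2.2
    exact ⟨a', b', (h1'.mono hL).trans (leg_marg hL h1), hb',
      (h2'.mono hL).trans (leg_marg hL h2)⟩
  · rintro ⟨a, b, h1, hb, h2⟩
    obtain ⟨a', ha', h3, h4⟩ := leg_to_marg h1 hj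
    obtain ⟨b', hb', h5, h6⟩ := leg_to_marg h2 hk
    exact ⟨a', b', h4, ⟨ha', hb', (trek_iff _ _ _ _).2 ⟨a, b, h3, hb, h5⟩⟩, h6⟩

theorem tconn_of {G G' : MixedGraph V} {T L : Set V} (hL : L ⊆ T)
    (H : ∀ j ∈ T, ∀ k ∈ T, Tr G L j k → Tr G' L j k) {j k : V} (h : G.TConn L j k)
    (hj : j ∈ T) (hk : k ∈ T) : G'.TConn L j k := by
  induction h with
  | single w hw ht hb =>
    obtain ⟨w', a, b, c⟩ := (trek_iff' _ _ _ _).2 (H _ hj _ hk ((trek_iff' _ _ _ _).1 ⟨w, hw, ht, hb⟩))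
    exact .single w' a b c
  | cons w hw ht hb hm _ ih =>
    obtain ⟨w', a, b, c⟩ := (trek_iff' _ _ _ _).2
      (H _ hj _ (hL hm) ((trek_iff' _ _ _ _).1 ⟨w, hw, ht, hb⟩))
    exact .cons w' a b c hm (ih (hL hm) hk)

end MargAux

/-- Marginalization preserves t-connection. -/
theorem marg_preserves_tconn {V : Type*} (G : MixedGraph V) (hsymm : G.BiSymm)
    (T J K L : Set V) (hJ : J ⊆ T) (hK : K ⊆ T) (hL : L ⊆ T) :
    (∃ j ∈ J, ∃ k ∈ K, (G.marg T).TConn L j k) ↔ ∃ j ∈ J, ∃ k ∈ K, G.TConn L j k := by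
  constructor
  · rintro ⟨j, hj, k, hk, h⟩
    exact ⟨j, hj, k, hk, MargAux.tconn_of hL
      (fun _ h1 _ h2 => (MargAux.tr_iff hL h1 h2).1) h (hJ hj) (hK hk)⟩
  · rintro ⟨j, hj, k, hk, h⟩
    exact ⟨j, hj, k, hk, MargAux.tconn_of hL
      (fun _ h1 _ h2 => (MargAux.tr_iff hL h1 h2).2) h (hJ hj) (hK hk)⟩
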